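/- Characterization of the identity: for A, B ∈ ℝ^{n×n}, A ⊗ₛ B = I_{n̄} if and only if there exists a real scalar λ ≠ 0 with A = λ I_n and B = (1/λ) I_n. -/

import Mathlib

open Matrix

noncomputable section

/-- `n̄ = n(n+1)/2`, the dimension of the space of symmetric `n × n` matrices. -/
def triDim (n : ℕ) : ℕ := n * (n + 1) / 2

/-- The (0-based) row/column pair `(r(j), c(j))` of the `j`-th position in the
lexicographic (left-to-right, top-to-bottom) enumeration of the on-or-above-diagonal
positions of an `n × n` matrix. -/
def rcPair : ℕ → ℕ → ℕ × ℕ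
  | 0, _ => (0, 0)
  | (m + 1), j =>
      if j < m + 1 then (0, j)
      else ((rcPair m (j - (m + 1))).1 + 1, (rcPair m (j - (m + 1))).2 + 1)

/-- The orthonormal basis `E_j` of the space of symmetric `n × n` matrices:
`E_j = e_{r(j)} e_{c(j)}ᵀ` if `r(j) = c(j)`, and
`E_j = (√2/2) (e_{r(j)} e_{c(j)}ᵀ + e_{c(j)} e_{r(j)}ᵀ)` if `r(j) < c(j)`. -/
def symBasis (n : ℕ) (j : Fin (triDim n)) : Matrix (Fin n) (Fin n) ℝ :=
  if (rcPair n j).1 = (rcPair n j).2 then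
    Matrix.of fun a b : Fin n =>
      if (a : ℕ) = (rcPair n j).1 ∧ (b : ℕ) = (rcPair n j).2 then (1 : ℝ) else 0
  else
    Matrix.of fun a b : Fin n =>
      if ((a : ℕ) = (rcPair n j).1 ∧ (b : ℕ) = (rcPair n j).2) ∨
          ((a : ℕ) = (rcPair n j).2 ∧ (b : ℕ) = (rcPair n j).1) then
        Real.sqrt 2 / 2
      else 0

/-- Column-stacking vectorization `vec : ℝ^{m×n} → ℝ^{nm}`: `vec(A)_{j·m + i} = A_{i,j}`
(0-based), realized through `finProdFinEquiv (j, i) = j * m + i`. -/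
def mvec {m n : ℕ} (A : Matrix (Fin m) (Fin n) ℝ) : Fin (n * m) → ℝ :=
  fun k => A (finProdFinEquiv.symm k).2 (finProdFinEquiv.symm k).1

/-- The matrix `W_n ∈ ℝ^{n̄ × n²}` whose `j`-th row is `vec(E_j)ᵀ`. -/
def Wmat (n : ℕ) : Matrix (Fin (triDim n)) (Fin (n * n)) ℝ :=
  Matrix.of fun j k => mvec (symBasis n j) k

/-- The Kronecker product on `Fin`-indexed matrices, with the standard flattening
`(A ⊗ B)_{(i·p + k, j·q + l)} = A_{i,j} B_{k,l}`. -/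
def kron {m n p q : ℕ} (A : Matrix (Fin m) (Fin n) ℝ) (B : Matrix (Fin p) (Fin q) ℝ) :
    Matrix (Fin (m * p)) (Fin (n * q)) ℝ :=
  Matrix.reindex finProdFinEquiv finProdFinEquiv (Matrix.kroneckerMap (· * ·) A B)

/-- The symmetric Kronecker product `A ⊗ₛ B = W_m (A ⊗ B) W_nᵀ ∈ ℝ^{m̄ × n̄}`
of rectangular matrices `A, B ∈ ℝ^{m×n}`. -/
def skron {m n : ℕ} (A B : Matrix (Fin m) (Fin n) ℝ) :
    Matrix (Fin (triDim m)) (Fin (triDim n)) ℝ :=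
  Wmat m * kron A B * (Wmat n)ᵀ

/-- The Frobenius inner product `⟨A, B⟩_F = trace(Aᵀ B)`. -/
def frobInner {m n : ℕ} (A B : Matrix (Fin m) (Fin n) ℝ) : ℝ :=
  (Aᵀ * B).trace

/-- Symmetric vectorization `svec(P)_j = ⟨P, E_j⟩_F`. -/
def svec {n : ℕ} (P : Matrix (Fin n) (Fin n) ℝ) : Fin (triDim n) → ℝ :=
  fun j => frobInner P (symBasis n j)

/-- The symmetric part `π(A) = (A + Aᵀ)/2`. -/
def symPart {n : ℕ} (A : Matrix (Fin n) (Fin n) ℝ) : Matrix (Fin n) (Fin n) ℝ :=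
  (1 / 2 : ℝ) • (A + Aᵀ)

/-- The symmetric Kronecker sum `A ⊕ₛ B = A ⊗ₛ I + I ⊗ₛ B`. -/
def skronSum {n : ℕ} (A B : Matrix (Fin n) (Fin n) ℝ) :
    Matrix (Fin (triDim n)) (Fin (triDim n)) ℝ :=
  skron A 1 + skron 1 B

/-- A vector `x ∈ ℝⁿ` regarded as an `n × 1` matrix. -/
def colVec {n : ℕ} (x : Fin n → ℝ) : Matrix (Fin n) (Fin 1) ℝ :=
  Matrix.of fun i _ => x i

/-- The size of the upper triangle grows by one row of length `n + 1`. -/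
theorem triDim_succ (n : ℕ) : triDim (n + 1) = triDim n + (n + 1) := by
  have h : (n + 1) * (n + 1 + 1) = n * (n + 1) + (n + 1) * 2 := by ring
  rw [triDim, triDim, h, Nat.add_mul_div_right _ _ two_pos]

theorem rcPair_mem : ∀ {n j : ℕ}, j < triDim n →
    (rcPair n j).1 ≤ (rcPair n j).2 ∧ (rcPair n j).2 < n
  | 0, j, h => by simp [triDim] at h
  | n + 1, j, h => by
    rw [triDim_succ] at h
    by_cases hj : j < n + 1
    · simp [rcPair, hj]
    · have := rcPair_mem (n := n) (j := j - (n + 1)) (by omega)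
      simp only [rcPair, hj, if_false]
      omega

theorem rcPair_injective : ∀ {n i j : ℕ}, i < triDim n → j < triDim n →
    rcPair n i = rcPair n j → i = j
  | 0, i, j, hi, _, _ => by simp [triDim] at hi
  | n + 1, i, j, hi, hj, h => by
    rw [triDim_succ] at hi hj
    by_cases h₁ : i < n + 1 <;> by_cases h₂ : j < n + 1 <;>
      simp only [rcPair, h₁, h₂, if_true, if_false, Prod.mk.injEq] at h
    · exact h.2
    · omega
    · omega
    · have := rcPair_injective (n := n) (i := i - (n + 1)) (j := j - (n + 1)) (by omega)
        (by omega) (Prod.ext (by omega) (by omega))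
      omega

theorem exists_rcPair_eq : ∀ {n a b : ℕ}, a ≤ b → b < n →
    ∃ j < triDim n, rcPair n j = (a, b)
  | 0, _, _, _, hb => by omega
  | n + 1, 0, b, _, hb => ⟨b, by rw [triDim_succ]; omega, by simp [rcPair, hb]⟩
  | n + 1, a + 1, 0, hab, _ => by omega
  | n + 1, a + 1, b + 1, hab, hb => by
    obtain ⟨j, hj, h⟩ := exists_rcPair_eq (n := n) (a := a) (b := b) (by omega) (by omega)
    exact ⟨j + (n + 1), by rw [triDim_succ]; omega, by
      simp [rcPair, h, show ¬ j + (n + 1) < n + 1 by omega]⟩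

/-- The normalizing factor of `e_a e_bᵀ + e_b e_aᵀ` in the Frobenius norm. -/
def symWeight {n : ℕ} (a b : Fin n) : ℝ := if a = b then 1 / 2 else √2 / 2

theorem symWeight_ne_zero {n : ℕ} (a b : Fin n) : symWeight a b ≠ 0 := by
  unfold symWeight
  split_ifs <;> positivity

theorem symBasis_eq {n : ℕ} {j : Fin (triDim n)} {a b : Fin n}
    (h : rcPair n j = ((a : ℕ), (b : ℕ))) :
    symBasis n j = symWeight a b • (single a b 1 + single b a 1) := by
  ext x y
  rcases eq_or_ne a b with rfl | hab
  · simp only [symBasis, h, symWeight, if_true, of_apply, Matrix.smul_apply,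
      Matrix.add_apply, single_apply, ← Fin.ext_iff, smul_eq_mul, eq_comm (a := a)]
    split_ifs <;> norm_num
  · simp only [symBasis, h, symWeight, ← Fin.ext_iff, hab, if_false, of_apply, Matrix.smul_apply,
      Matrix.add_apply, single_apply, smul_eq_mul, eq_comm (a := a), eq_comm (a := b)]
    by_cases hx : x = a <;> by_cases hy : y = b <;> by_cases hx' : x = b <;>
      by_cases hy' : y = a <;> simp_all

theorem skron_apply {n : ℕ} (A B : Matrix (Fin n) (Fin n) ℝ) (i j : Fin (triDim n)) :
    skron A B i j = ((symBasis n i)ᵀ * (B * symBasis n j * Aᵀ)).trace := by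
  have h : skron A B i j = mvec (symBasis n i) ⬝ᵥ kron A B *ᵥ mvec (symBasis n j) := by
    rw [skron, Matrix.mul_assoc]
    rfl
  have hv : ∀ X : Matrix (Fin n) (Fin n) ℝ, mvec X = vec X ∘ finProdFinEquiv.symm := fun _ => rfl
  rw [h, kron, reindex_apply, hv, hv, submatrix_mulVec_equiv, comp_equiv_dotProduct_comp_equiv,
    Function.comp_assoc, Equiv.symm_symm, Equiv.symm_comp_self, Function.comp_id,
    kronecker_mulVec_vec, vec_dotProduct_vec]

theorem skron_apply_of_rcPair {n : ℕ} (A B : Matrix (Fin n) (Fin n) ℝ)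
    {i j : Fin (triDim n)} {a b c d : Fin n}
    (hi : rcPair n i = ((a : ℕ), (b : ℕ))) (hj : rcPair n j = ((c : ℕ), (d : ℕ))) :
    skron A B i j = symWeight a b * symWeight c d *
      (B a c * A b d + B a d * A b c + B b c * A a d + B b d * A a c) := by
  have h : ∀ p q r s : Fin n,
      (single p q 1 * (B * single r s 1 * Aᵀ)).trace = B q r * A p s := fun p q r s => by
    rw [trace_single_mul, mul_single_eq_updateCol_zero]
    simp [mul_apply, updateCol_apply]
  rw [skron_apply, symBasis_eq hi, symBasis_eq hj]
  simp only [transpose_smul, transpose_add, transpose_single, Matrix.mul_smul, Matrix.smul_mul,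
    trace_smul, Matrix.mul_add, Matrix.add_mul, trace_add, smul_eq_mul, h]
  ring

/-- All entries of `A ⊗ₛ B = I`, indexed by pairs of ordered pairs. -/
theorem skron_eq_one_iff_forall {n : ℕ} (A B : Matrix (Fin n) (Fin n) ℝ) :
    skron A B = 1 ↔ ∀ a b c d : Fin n, a ≤ b → c ≤ d →
      B a c * A b d + B a d * A b c + B b c * A a d + B b d * A a c =
        2 * ((if a = c ∧ b = d then 1 else 0) + if a = d ∧ b = c then 1 else 0) := by
  have key : ∀ a b c d : Fin n, a ≤ b → c ≤ d →
      symWeight a b * symWeight c d *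
        (2 * ((if a = c ∧ b = d then 1 else 0) + if a = d ∧ b = c then 1 else 0)) =
        if a = c ∧ b = d then 1 else 0 := by
    intro a b c d hab hcd
    by_cases h : a = c ∧ b = d
    · obtain ⟨rfl, rfl⟩ := h
      by_cases h : a = b
      · subst h; norm_num [symWeight]
      · have := Real.mul_self_sqrt (show (0 : ℝ) ≤ 2 by norm_num)
        simp only [symWeight, h, and_self, false_and, if_true, if_false]
        linarith
    · have h' : ¬ (a = d ∧ b = c) := by
        rintro ⟨rfl, rfl⟩
        exact h ⟨le_antisymm hab hcd, le_antisymm hcd hab⟩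
      simp [h, h']
  constructor
  · intro h a b c d hab hcd
    obtain ⟨i, hi, hi'⟩ := exists_rcPair_eq (n := n) hab b.isLt
    obtain ⟨j, hj, hj'⟩ := exists_rcPair_eq (n := n) hcd d.isLt
    have e := congrFun₂ h ⟨i, hi⟩ ⟨j, hj⟩
    rw [skron_apply_of_rcPair A B (i := ⟨i, hi⟩) (j := ⟨j, hj⟩) hi' hj'] at e
    refine mul_left_cancel₀ (mul_ne_zero (symWeight_ne_zero a b) (symWeight_ne_zero c d)) ?_
    rw [e, key a b c d hab hcd, one_apply]
    refine if_congr ?_ rfl rfl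
    rw [Fin.mk.injEq]
    constructor
    · rintro rfl
      simpa [Fin.ext_iff] using hi'.symm.trans hj'
    · rintro ⟨rfl, rfl⟩
      exact rcPair_injective hi hj (hi'.trans hj'.symm)
  · intro h
    ext i j
    have hi := rcPair_mem i.isLt
    have hj := rcPair_mem j.isLt
    rw [skron_apply_of_rcPair A B (a := ⟨_, hi.1.trans_lt hi.2⟩) (b := ⟨_, hi.2⟩)
      (c := ⟨_, hj.1.trans_lt hj.2⟩) (d := ⟨_, hj.2⟩) rfl rfl,
      h _ _ _ _ hi.1 hj.1, key _ _ _ _ hi.1 hj.1, one_apply]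
    refine if_congr ?_ rfl rfl
    rw [Fin.mk.injEq, Fin.mk.injEq, ← Prod.ext_iff, Fin.ext_iff]
    exact ⟨rcPair_injective i.isLt j.isLt, fun h => by rw [h]⟩

/-- `A ⊗ₛ B = I_{n̄}` if and only if `A = λ I` and `B = (1/λ) I` for
some nonzero real scalar `λ`. -/
theorem skron_eq_one_iff (n : ℕ) (A B : Matrix (Fin n) (Fin n) ℝ) :
    skron A B = 1 ↔
      ∃ l : ℝ, l ≠ 0 ∧ A = l • (1 : Matrix (Fin n) (Fin n) ℝ) ∧
        B = l⁻¹ • (1 : Matrix (Fin n) (Fin n) ℝ) := by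
  rw [skron_eq_one_iff_forall]
  constructor
  · intro h
    have diag_mul : ∀ a, B a a * A a a = 1 := fun a => by
      have := h a a a a le_rfl le_rfl
      norm_num at this
      linarith
    have off_diag : ∀ a c, a ≠ c → A a c = 0 ∧ B a c = 0 := by
      intro a c hac
      have h₁ := h a a c c le_rfl le_rfl
      have h₂ : B a a * A a c + B a c * A a a = 0 := by
        rcases le_total a c with hle | hle
        · have := h a a a c le_rfl hle
          simp [hac] at this
          linarith
        · have := h a a c a le_rfl hle
          simp [hac] at this
          linarith
      simp [hac] at h₁
      have hA : A a c = 0 := by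
        have : B a a * A a c ^ 2 = 0 := by linear_combination A a c * h₂ - A a a / 4 * h₁
        simpa [left_ne_zero_of_mul_eq_one (diag_mul a)] using this
      refine ⟨hA, ?_⟩
      simpa [hA, right_ne_zero_of_mul_eq_one (diag_mul a)] using h₂
    have diag_eq : ∀ a b, A a a = A b b := by
      have of_lt : ∀ a b, a < b → A a a = A b b := by
        intro a b hab
        have h₁ := h a b a b hab.le hab.le
        simp [hab.ne, (off_diag a b hab.ne).1, (off_diag a b hab.ne).2] at h₁
        have ha := diag_mul a
        have hb := diag_mul b
        have : (A a a - A b b) ^ 2 = 0 := by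
          linear_combination A a a * A b b * h₁ - A b b ^ 2 * ha - A a a ^ 2 * hb
        exact sub_eq_zero.1 (pow_eq_zero_iff two_ne_zero |>.1 this)
      intro a b
      rcases lt_trichotomy a b with hab | rfl | hab
      · exact of_lt a b hab
      · rfl
      · exact (of_lt b a hab).symm
    rcases isEmpty_or_nonempty (Fin n) with hn | ⟨⟨o⟩⟩
    · exact ⟨1, one_ne_zero, Subsingleton.elim _ _, Subsingleton.elim _ _⟩
    refine ⟨A o o, right_ne_zero_of_mul_eq_one (diag_mul o), ?_, ?_⟩ <;> ext a c <;>
      rcases eq_or_ne a c with rfl | hac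
    · simp [diag_eq a o]
    · simp [hac, (off_diag a c hac).1]
    · simpa [← diag_eq a o] using eq_inv_of_mul_eq_one_left (diag_mul a)
    · simp [hac, (off_diag a c hac).2]
  · rintro ⟨l, hl, rfl, rfl⟩ a b c d - -
    simp only [Matrix.smul_apply, one_apply, smul_eq_mul, ite_and]
    split_ifs <;> field_simp <;> norm_num
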